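/- F = F_∞ ∩ F₀ is a fundamental domain for the action of Γ = PSL₂(R) on H²×H²: the boundary of F has Lebesgue measure 0, the translates γ(F) for γ ∈ Γ cover H²×H², and for every γ ∈ Γ with γ ≠ 1 there is no point Z such that both Z and γ(Z) lie in the interior of F. -/

import Mathlib

noncomputable section

open scoped Classical
open MeasureTheory

namespace Hilbert

/-- `k₀ = 2` if `k ≡ 1 (mod 4)` and `k₀ = 1` otherwise. -/
def k0 (k : ℕ) : ℝ := if k % 4 = 1 then 2 else 1

/-- `ω = (1 + √k)/k₀`. -/
def omg (k : ℕ) : ℝ := (1 + Real.sqrt k) / k0 k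

/-- `ω' = (1 - √k)/k₀`, the algebraic conjugate of `ω`. -/
def omg' (k : ℕ) : ℝ := (1 - Real.sqrt k) / k0 k

/-- The ring `R = ℤ[ω]`, realized inside `ℝ × ℝ` via the pair of real embeddings
`α ↦ (α, α')` of `K = ℚ(√k)`. -/
def R (k : ℕ) : Subring (ℝ × ℝ) := Subring.closure {(omg k, omg' k)}

/-- The ambient space `ℝ⁴`, with coordinates `(x₁, x₂, y₁, y₂)`. -/
abbrev Pt : Type := ℝ × ℝ × ℝ × ℝ

def x1 (p : Pt) : ℝ := p.1
def x2 (p : Pt) : ℝ := p.2.1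
def y1 (p : Pt) : ℝ := p.2.2.1
def y2 (p : Pt) : ℝ := p.2.2.2

/-- `H² × H²`, identified with an open subset of `ℝ⁴`. -/
def HH : Set Pt := {p | 0 < y1 p ∧ 0 < y2 p}

/-- The coordinate `s₁`, determined by `x₁ = s₁ + s₂ ω`, `x₂ = s₁ + s₂ ω'`. -/
def s1 (k : ℕ) (p : Pt) : ℝ := (omg' k * x1 p - omg k * x2 p) / (omg' k - omg k)

/-- The coordinate `s₂`. -/
def s2 (k : ℕ) (p : Pt) : ℝ := (x1 p - x2 p) / (omg k - omg' k)

/-- The ratio `r = y₁/y₂`. -/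
def rr (p : Pt) : ℝ := y1 p / y2 p

/-- The height `h = y₁ y₂`. -/
def hh (p : Pt) : ℝ := y1 p * y2 p

/-- `‖cZ+d‖ = ((cx₁+d)² + c²y₁²)((c'x₂+d')² + c'²y₂²)`, where `c = (c, c')`, `d = (d, d')`
are given by their two real embeddings. -/
def HNorm (c d : ℝ × ℝ) (p : Pt) : ℝ :=
  ((c.1 * x1 p + d.1) ^ 2 + c.1 ^ 2 * y1 p ^ 2) *
    ((c.2 * x2 p + d.2) ^ 2 + c.2 ^ 2 * y2 p ^ 2)

/-- `S = {(c,d) ∈ R² : cR + dR = R}`. -/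
def Spairs (k : ℕ) : Set (R k × R k) := {cd | Ideal.span {cd.1, cd.2} = ⊤}

/-- `V_{c,d}^≥ = {Z ∈ H²×H² : ‖cZ+d‖ ≥ 1}`. -/
def Vge (k : ℕ) (cd : R k × R k) : Set Pt :=
  {p ∈ HH | 1 ≤ HNorm (cd.1 : ℝ × ℝ) (cd.2 : ℝ × ℝ) p}

/-- `V_{c,d}^≤ = {Z ∈ H²×H² : ‖cZ+d‖ ≤ 1}`. -/
def Vle (k : ℕ) (cd : R k × R k) : Set Pt :=
  {p ∈ HH | HNorm (cd.1 : ℝ × ℝ) (cd.2 : ℝ × ℝ) p ≤ 1}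

/-- `V_{c,d} = {Z ∈ H²×H² : ‖cZ+d‖ = 1}`. -/
def Veq (k : ℕ) (cd : R k × R k) : Set Pt :=
  {p ∈ HH | HNorm (cd.1 : ℝ × ℝ) (cd.2 : ℝ × ℝ) p = 1}

/-- `F₀ = {Z ∈ H²×H² : ‖cZ+d‖ ≥ 1 for all (c,d) ∈ S}`. -/
def F0 (k : ℕ) : Set Pt :=
  {p ∈ HH | ∀ cd ∈ Spairs k, 1 ≤ HNorm (cd.1 : ℝ × ℝ) (cd.2 : ℝ × ℝ) p}

/-- `F_∞ = {(s₁,s₂,r,h) : |s₁| ≤ 1/2, |s₂| ≤ 1/2, ε₀⁻² ≤ r ≤ ε₀²}`, where `ε` stands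
for the fundamental unit `ε₀`. -/
def FInf (k : ℕ) (ε : ℝ) : Set Pt :=
  {p ∈ HH | |s1 k p| ≤ 1 / 2 ∧ |s2 k p| ≤ 1 / 2 ∧ (ε ^ 2)⁻¹ ≤ rr p ∧ rr p ≤ ε ^ 2}

/-- `F = F_∞ ∩ F₀`. -/
def F (k : ℕ) (ε : ℝ) : Set Pt := FInf k ε ∩ F0 k

/-- `SL₂(R)`. -/
abbrev SL (k : ℕ) := Matrix.SpecialLinearGroup (Fin 2) (R k)

/-- Möbius action on the upper half-plane: image of `x + y i` under `(a b; c d)`. -/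
def moeb (a b c d x y : ℝ) : ℝ × ℝ :=
  (((a * x + b) * (c * x + d) + a * c * y ^ 2) / ((c * x + d) ^ 2 + c ^ 2 * y ^ 2),
    y / ((c * x + d) ^ 2 + c ^ 2 * y ^ 2))

/-- The action of `γ ∈ SL₂(R)` on `H²×H²`: `γ` acts on the first factor through the first
embedding and through the conjugate matrix `γ'` (second embedding) on the second factor.
This descends to the Hilbert modular group `PSL₂(R)`. -/
def act (k : ℕ) (g : SL k) (p : Pt) : Pt :=
  ((moeb (g.1 0 0 : ℝ × ℝ).1 (g.1 0 1 : ℝ × ℝ).1 (g.1 1 0 : ℝ × ℝ).1 (g.1 1 1 : ℝ × ℝ).1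
      (x1 p) (y1 p)).1,
   (moeb (g.1 0 0 : ℝ × ℝ).2 (g.1 0 1 : ℝ × ℝ).2 (g.1 1 0 : ℝ × ℝ).2 (g.1 1 1 : ℝ × ℝ).2
      (x2 p) (y2 p)).1,
   (moeb (g.1 0 0 : ℝ × ℝ).1 (g.1 0 1 : ℝ × ℝ).1 (g.1 1 0 : ℝ × ℝ).1 (g.1 1 1 : ℝ × ℝ).1
      (x1 p) (y1 p)).2,
   (moeb (g.1 0 0 : ℝ × ℝ).2 (g.1 0 1 : ℝ × ℝ).2 (g.1 1 0 : ℝ × ℝ).2 (g.1 1 1 : ℝ × ℝ).2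
      (x2 p) (y2 p)).2)

/-- The pair of real embeddings of a unit of `R`. -/
def unitVal (k : ℕ) (u : (R k)ˣ) : ℝ × ℝ := ((u : R k) : ℝ × ℝ)

/-- `e` is the fundamental unit of `R`: the smallest unit of `R` greater than `1`
(with respect to the first embedding). -/
def IsFundUnit (k : ℕ) (e : (R k)ˣ) : Prop :=
  1 < (unitVal k e).1 ∧
    ∀ v : (R k)ˣ, 1 < (unitVal k v).1 → (unitVal k e).1 ≤ (unitVal k v).1

/-- The real number `ε₀ > 1`, the fundamental unit under the first embedding. -/
def eps (k : ℕ) (e : (R k)ˣ) : ℝ := (unitVal k e).1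


/-- The norm `N(c) = c c'` of an element of `R` (as a real number). -/
def Nm (k : ℕ) (c : R k) : ℝ := ((c : ℝ × ℝ)).1 * ((c : ℝ × ℝ)).2

/-- A subset `C` of `H²×H²` is hyperbolically bounded if it is bounded in the
Euclidean metric and `y₁, y₂ > ε` on `C` for some `ε > 0`. -/
def HypBounded (C : Set Pt) : Prop :=
  C ⊆ HH ∧ Bornology.IsBounded C ∧ ∃ ε > (0 : ℝ), ∀ p ∈ C, ε < y1 p ∧ ε < y2 p

/-- `V_{C,μ} = {(c,d) ∈ R × R : ‖cZ+d‖ ≤ μ for some Z ∈ C}`. -/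
def VCmu (k : ℕ) (C : Set Pt) (μ : ℝ) : Set (R k × R k) :=
  {cd | ∃ p ∈ C, HNorm (cd.1 : ℝ × ℝ) (cd.2 : ℝ × ℝ) p ≤ μ}

/-- The conditions (8) of Theorem `FiniteSides` on a pair `(c,d) ∈ R²`. -/
def SCond (k : ℕ) (ε : ℝ) (cd : R k × R k) : Prop :=
  cd.1 ≠ 0 ∧ Ideal.span {cd.1, cd.2} = ⊤ ∧
    |Nm k cd.1| ≤ 2 * k / (k0 k) ^ 2 ∧
    |((cd.2 : ℝ × ℝ)).1 / ((cd.1 : ℝ × ℝ)).1| <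
      ε * Real.sqrt (2 * k / (Nm k cd.1 ^ 2 * (k0 k) ^ 2) - (k0 k) ^ 2 / (2 * k)) +
        (1 + omg k) / 2 ∧
    |((cd.2 : ℝ × ℝ)).2 / ((cd.1 : ℝ × ℝ)).2| <
      ε * Real.sqrt (2 * k / (Nm k cd.1 ^ 2 * (k0 k) ^ 2) - (k0 k) ^ 2 / (2 * k)) +
        (1 - omg' k) / 2

/-- `S₁` is a set of representatives, up to multiplication by units of `R`, of the pairs
`(c,d) ∈ R²` satisfying the conditions `SCond`. -/
def IsRepSet (k : ℕ) (ε : ℝ) (S1 : Set (R k × R k)) : Prop :=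
  (∀ cd ∈ S1, SCond k ε cd) ∧
    (∀ cd : R k × R k, SCond k ε cd →
      ∃ ab ∈ S1, ∃ u : (R k)ˣ, cd.1 = (u : R k) * ab.1 ∧ cd.2 = (u : R k) * ab.2) ∧
    (∀ ab ∈ S1, ∀ ab' ∈ S1,
      (∃ u : (R k)ˣ, ab'.1 = (u : R k) * ab.1 ∧ ab'.2 = (u : R k) * ab.2) → ab = ab')

/-- The family `𝒱_∞ = {V_i^± : i = 1,2,3}`. -/
def VfamInf (k : ℕ) (ε : ℝ) : Set (Set Pt) :=
  { {p ∈ HH | s1 k p = 1 / 2}, {p ∈ HH | s1 k p = -(1 / 2)},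
    {p ∈ HH | s2 k p = 1 / 2}, {p ∈ HH | s2 k p = -(1 / 2)},
    {p ∈ HH | rr p = ε ^ 2}, {p ∈ HH | rr p = (ε ^ 2)⁻¹} }

/-- The family `𝒱 = {V_{c,d} : (c,d) ∈ S, c ≠ 0}`. -/
def Vfam (k : ℕ) : Set (Set Pt) :=
  {V | ∃ cd ∈ Spairs k, cd.1 ≠ 0 ∧ V = Veq k cd}

/-- The family `𝓜 = {γ(M) : γ ∈ Γ, M ∈ 𝒱 ∪ 𝒱_∞}`. -/
def Mfam (k : ℕ) (ε : ℝ) : Set (Set Pt) :=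
  {M | ∃ g : SL k, ∃ V ∈ Vfam k ∪ VfamInf k ε, M = act k g '' V}

/-- `ω` as an element of `R`. -/
def omR (k : ℕ) : R k := ⟨(omg k, omg' k), Subring.subset_closure rfl⟩

/-- The side-pairing transformations: `γ ≠ 1` (in `PSL₂(R)`) such that `F ∩ γ⁻¹(F)` has
Hausdorff dimension `3`. -/
def SidePairings (k : ℕ) (ε : ℝ) : Set (SL k) :=
  {g | g ≠ 1 ∧ g.1 ≠ -1 ∧ dimH (F k ε ∩ act k g⁻¹ '' F k ε) = 3}


lemma k0_pos (k : ℕ) : 0 < k0 k := by unfold k0; split_ifs <;> norm_num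

lemma sqrt_irr {k : ℕ} (hk : Squarefree k) (hk1 : 1 < k) : Irrational (Real.sqrt k) := by
  rw [irrational_sqrt_natCast_iff]
  rintro ⟨m, rfl⟩
  have := hk m (dvd_refl _)
  rw [Nat.isUnit_iff] at this
  subst this
  simp at hk1

lemma exists_quad (k : ℕ) :
    ∃ t n : ℤ, omg k + omg' k = t ∧ omg k * omg' k = -n := by
  have hs : Real.sqrt k * Real.sqrt k = k := Real.mul_self_sqrt (Nat.cast_nonneg k)
  by_cases h : k % 4 = 1
  · refine ⟨1, (k / 4 : ℕ), ?_, ?_⟩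
    · simp only [omg, omg', k0, h, if_true]; push_cast; ring
    · simp only [omg, omg', k0, h, if_true]
      have h2 : k = 4 * (k / 4) + 1 := by omega
      have h3 : (k : ℝ) = 4 * ((k / 4 : ℕ) : ℝ) + 1 := by exact_mod_cast h2
      rw [Int.cast_natCast]
      linear_combination (-1/4) * hs - (1/4) * h3
  · refine ⟨2, (k : ℤ) - 1, ?_, ?_⟩
    · simp only [omg, omg', k0, h, if_false]; push_cast; ring
    · simp only [omg, omg', k0, h, if_false]; push_cast
      linear_combination - hs

lemma omg_sub_pos {k : ℕ} (hk1 : 1 < k) : 0 < omg k - omg' k := by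
  have h0 := k0_pos k
  have : 0 < Real.sqrt k := Real.sqrt_pos.2 (by exact_mod_cast (by omega : 0 < k))
  have e : omg k - omg' k = 2 * Real.sqrt k / k0 k := by unfold omg omg'; ring
  rw [e]; positivity

lemma omg_ne {k : ℕ} (hk1 : 1 < k) : omg k ≠ 0 := by
  have h0 := k0_pos k
  have : 0 < Real.sqrt k := Real.sqrt_pos.2 (by exact_mod_cast (by omega : 0 < k))
  unfold omg; positivity

lemma mem_R {k : ℕ} {z : ℝ × ℝ} (hz : z ∈ R k) :
    ∃ a b : ℤ, z = (a + b * omg k, a + b * omg' k) := by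
  obtain ⟨t, n, ht, hn⟩ := exists_quad k
  unfold R at hz
  induction hz using Subring.closure_induction with
  | mem x hx => exact ⟨0, 1, by rw [Set.mem_singleton_iff.1 hx]; simp⟩
  | zero => exact ⟨0, 0, by ext <;> simp⟩
  | one => exact ⟨1, 0, by ext <;> simp⟩
  | add x y hx hy h1 h2 =>
    obtain ⟨a, b, rfl⟩ := h1
    obtain ⟨c, d, rfl⟩ := h2
    exact ⟨a + c, b + d, by ext <;> simp <;> ring⟩
  | neg x hx h1 =>
    obtain ⟨a, b, rfl⟩ := h1
    exact ⟨-a, -b, by ext <;> simp <;> ring⟩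
  | mul x y hx hy h1 h2 =>
    obtain ⟨a, b, rfl⟩ := h1
    obtain ⟨c, d, rfl⟩ := h2
    refine ⟨a * c + b * d * n, a * d + b * c + b * d * t, ?_⟩
    ext
    · simp; linear_combination (b * d * omg k : ℝ) * ht - (b * d : ℝ) * hn
    · simp; linear_combination (b * d * omg' k : ℝ) * ht - (b * d : ℝ) * hn

def ofInt (k : ℕ) (a b : ℤ) : R k := (a : R k) + (b : R k) * omR k

lemma ofInt_1 (k : ℕ) (a b : ℤ) : (ofInt k a b : ℝ × ℝ).1 = a + b * omg k := by
  simp [ofInt, omR]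
lemma ofInt_2 (k : ℕ) (a b : ℤ) : (ofInt k a b : ℝ × ℝ).2 = a + b * omg' k := by
  simp [ofInt, omR]

lemma exists_ofInt {k : ℕ} (c : R k) : ∃ a b : ℤ, c = ofInt k a b := by
  obtain ⟨a, b, h⟩ := mem_R c.2
  refine ⟨a, b, Subtype.ext ?_⟩
  rw [h]; ext
  · rw [ofInt_1]
  · rw [ofInt_2]

lemma int_lin {k : ℕ} (hk : Squarefree k) (hk1 : 1 < k) (s : ℝ) (hs : s = 1 ∨ s = -1) (a b : ℤ)
    (h : (a : ℝ) + b * ((1 + s * Real.sqrt k) / k0 k) = 0) : a = 0 ∧ b = 0 := by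
  have h0 := k0_pos k
  have irr := sqrt_irr hk hk1
  have hb : b = 0 := by
    by_contra hb
    have hb' : (b : ℝ) ≠ 0 := by exact_mod_cast hb
    obtain ⟨m, hm⟩ : ∃ m : ℤ, k0 k = m := by
      unfold k0; split_ifs
      · exact ⟨2, by norm_num⟩
      · exact ⟨1, by norm_num⟩
    apply irr
    have h1 : s * Real.sqrt k = - a * m / b - 1 := by
      rw [hm] at h h0
      field_simp at h ⊢
      linear_combination h
    rcases hs with rfl | rfl
    · exact ⟨(- a * m / b - 1 : ℚ), by push_cast; linarith⟩
    · exact ⟨-(- a * m / b - 1 : ℚ), by push_cast; linarith⟩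
  subst hb
  simp at h
  exact ⟨h, rfl⟩

lemma R_inj1 {k : ℕ} (hk : Squarefree k) (hk1 : 1 < k) (c : R k) (h : (c : ℝ × ℝ).1 = 0) :
    c = 0 := by
  obtain ⟨a, b, rfl⟩ := exists_ofInt c
  rw [ofInt_1] at h
  obtain ⟨rfl, rfl⟩ := int_lin hk hk1 1 (Or.inl rfl) a b (by rw [← h]; unfold omg; ring)
  simp [ofInt]

lemma R_inj2 {k : ℕ} (hk : Squarefree k) (hk1 : 1 < k) (c : R k) (h : (c : ℝ × ℝ).2 = 0) :
    c = 0 := by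
  obtain ⟨a, b, rfl⟩ := exists_ofInt c
  rw [ofInt_2] at h
  obtain ⟨rfl, rfl⟩ := int_lin hk hk1 (-1) (Or.inr rfl) a b (by rw [← h]; unfold omg'; ring)
  simp [ofInt]

lemma norm_int {k : ℕ} (c : R k) : ∃ n : ℤ, (c : ℝ × ℝ).1 * (c : ℝ × ℝ).2 = n := by
  obtain ⟨a, b, rfl⟩ := exists_ofInt c
  obtain ⟨t, n, ht, hn⟩ := exists_quad k
  refine ⟨a ^ 2 + a * b * t - b ^ 2 * n, ?_⟩
  rw [ofInt_1, ofInt_2]; push_cast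
  linear_combination (a * b : ℝ) * ht + (b ^ 2 : ℝ) * hn

lemma unit_mul1 {k : ℕ} (u : (R k)ˣ) :
    ((u : R k) : ℝ × ℝ).1 * (((u⁻¹ : (R k)ˣ) : R k) : ℝ × ℝ).1 = 1 := by
  have h : (u : R k) * ((u⁻¹ : (R k)ˣ) : R k) = 1 := Units.mul_inv u
  have := congrArg (fun z : R k => (z : ℝ × ℝ).1) h
  exact this

lemma unit_mul2 {k : ℕ} (u : (R k)ˣ) :
    ((u : R k) : ℝ × ℝ).2 * (((u⁻¹ : (R k)ˣ) : R k) : ℝ × ℝ).2 = 1 := by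
  have h : (u : R k) * ((u⁻¹ : (R k)ˣ) : R k) = 1 := Units.mul_inv u
  have := congrArg (fun z : R k => (z : ℝ × ℝ).2) h
  exact this

lemma unit_norm {k : ℕ} (u : (R k)ˣ) :
    ((u : R k) : ℝ × ℝ).1 ^ 2 * ((u : R k) : ℝ × ℝ).2 ^ 2 = 1 := by
  obtain ⟨n, hn⟩ := norm_int (u : R k)
  obtain ⟨m, hm⟩ := norm_int ((u⁻¹ : (R k)ˣ) : R k)
  have h1 := unit_mul1 u
  have h2 := unit_mul2 u
  have h3 : (n : ℝ) * m = 1 := by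
    rw [← hn, ← hm]
    linear_combination h1 * (((u : R k) : ℝ × ℝ).2 * (((u⁻¹ : (R k)ˣ) : R k) : ℝ × ℝ).2) + h2
  have h4 : n * m = 1 := by exact_mod_cast h3
  have h5 : n = 1 ∨ n = -1 := Int.isUnit_iff.1 (IsUnit.of_mul_eq_one _ h4)
  rw [← mul_pow, hn]
  rcases h5 with rfl | rfl <;> norm_num

lemma unit_zpow1 {k : ℕ} (u : (R k)ˣ) (n : ℤ) :
    (((u ^ n : (R k)ˣ) : R k) : ℝ × ℝ).1 = ((u : R k) : ℝ × ℝ).1 ^ n := by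
  have := congrArg (fun z : ℝˣ => (z : ℝ))
    (map_zpow (Units.map ((RingHom.fst ℝ ℝ).comp (R k).subtype : R k →* ℝ)) u n)
  rw [Units.val_zpow_eq_zpow_val] at this
  exact this

lemma finite_box {k : ℕ} (hk1 : 1 < k) (W : ℝ) :
    {c : R k | |(c : ℝ × ℝ).1| ≤ W ∧ |(c : ℝ × ℝ).2| ≤ W}.Finite := by
  have hd := omg_sub_pos hk1
  obtain ⟨N, hN⟩ := exists_nat_ge (2 * W / (omg k - omg' k))
  obtain ⟨M, hM⟩ := exists_nat_ge (W + N * |omg k|)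
  apply Set.Finite.subset (((Set.finite_Icc (-(M : ℤ)) M).prod (Set.finite_Icc (-(N : ℤ)) N)).image
    (fun z => ofInt k z.1 z.2))
  rintro c ⟨h1, h2⟩
  obtain ⟨a, b, rfl⟩ := exists_ofInt c
  rw [ofInt_1] at h1
  rw [ofInt_2] at h2
  have hb : |(b : ℝ)| ≤ N := by
    refine le_trans ?_ hN
    rw [le_div_iff₀ hd]
    calc |(b : ℝ)| * (omg k - omg' k) = |(b : ℝ) * (omg k - omg' k)| := by
          rw [abs_mul, abs_of_pos hd]
      _ = |(a + b * omg k) - (a + b * omg' k)| := by congr 1; ring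
      _ ≤ _ := (abs_sub _ _).trans (by linarith)
  have ha : |(a : ℝ)| ≤ M := by
    refine le_trans ?_ hM
    calc |(a : ℝ)| = |(a + b * omg k) - b * omg k| := by congr 1; ring
      _ ≤ |a + b * omg k| + |b * omg k| := abs_sub _ _
      _ ≤ _ := by rw [abs_mul (b : ℝ)]; gcongr
  refine ⟨(a, b), ⟨?_, ?_⟩, rfl⟩
  · rw [abs_le] at ha; constructor
    · exact_mod_cast ha.1
    · exact_mod_cast ha.2
  · rw [abs_le] at hb; constructor
    · exact_mod_cast hb.1
    · exact_mod_cast hb.2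

lemma bound1 {c d x y δ M L : ℝ} (hδ : 0 < δ) (hy : δ < y) (hx : |x| < M) (hL : 1 ≤ L)
    (h : (c * x + d) ^ 2 + c ^ 2 * y ^ 2 ≤ L) :
    |c| ≤ L + L / δ + L / δ * M ∧ |d| ≤ L + L / δ + L / δ * M := by
  have hM : 0 < M := lt_of_le_of_lt (abs_nonneg _) hx
  have hL2 : L ≤ L ^ 2 := by nlinarith
  have h1 : |c * y| ≤ L := abs_le_of_sq_le_sq (by nlinarith [sq_nonneg (c * x + d)]) (by linarith)
  have h2 : |c * x + d| ≤ L := abs_le_of_sq_le_sq (by nlinarith [sq_nonneg (c * y)]) (by linarith)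
  have h3 : |c| ≤ L / δ := by
    rw [le_div_iff₀ hδ]
    rw [abs_mul, abs_of_pos (hδ.trans hy)] at h1
    nlinarith [abs_nonneg c]
  have h4 : |d| ≤ L + L / δ * M := by
    calc |d| = |(c * x + d) - c * x| := by congr 1; ring
      _ ≤ |c * x + d| + |c * x| := abs_sub _ _
      _ ≤ _ := by rw [abs_mul c]; gcongr
  have h5 : 0 ≤ L / δ := by positivity
  have h6 : 0 ≤ L / δ * M := by positivity
  constructor <;> linarith

lemma den_pos {c d x y : ℝ} (hy : 0 < y) (h : c ≠ 0 ∨ d ≠ 0) :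
    0 < (c * x + d) ^ 2 + c ^ 2 * y ^ 2 := by
  by_cases hc : c = 0
  · subst hc
    have : d ≠ 0 := by simpa using h
    simp; positivity
  · positivity

lemma HNorm_unit {k : ℕ} (u : (R k)ˣ) (c d : R k) (p : Pt) :
    HNorm ((u * c : R k) : ℝ × ℝ) ((u * d : R k) : ℝ × ℝ) p = HNorm (c : ℝ × ℝ) (d : ℝ × ℝ) p := by
  have h := unit_norm u
  simp only [HNorm, Subring.coe_mul, Prod.fst_mul, Prod.snd_mul]
  linear_combination h * ((((c : ℝ × ℝ).1 * x1 p + (d : ℝ × ℝ).1) ^ 2 + (c : ℝ × ℝ).1 ^ 2 * y1 p ^ 2) *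
    (((c : ℝ × ℝ).2 * x2 p + (d : ℝ × ℝ).2) ^ 2 + (c : ℝ × ℝ).2 ^ 2 * y2 p ^ 2))

lemma loc_fin {k : ℕ} (hk : Squarefree k) (hk1 : 1 < k) (e : (R k)ˣ) (he : IsFundUnit k e)
    (p : Pt) (hp : p ∈ HH) (μ : ℝ) :
    ∃ U ∈ nhds p, ∃ T : Set (R k × R k), T.Finite ∧ ∀ q ∈ U, q ∈ HH ∧ ∀ c d : R k,
      (c ≠ 0 ∨ d ≠ 0) → HNorm (c : ℝ × ℝ) (d : ℝ × ℝ) q ≤ μ →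
      ∃ u : (R k)ˣ, ((u : R k) * c, (u : R k) * d) ∈ T := by
  obtain ⟨hp1, hp2⟩ := hp
  obtain ⟨δ, hδ, hδ1, hδ2⟩ : ∃ δ : ℝ, 0 < δ ∧ δ < y1 p ∧ δ < y2 p := by
    refine ⟨min (y1 p) (y2 p) / 2, by positivity, ?_, ?_⟩
    · linarith [min_le_left (y1 p) (y2 p)]
    · linarith [min_le_right (y1 p) (y2 p)]
  obtain ⟨M, hM1, hM2⟩ : ∃ M : ℝ, |x1 p| < M ∧ |x2 p| < M :=
    ⟨|x1 p| + |x2 p| + 1, by linarith [abs_nonneg (x2 p)], by linarith [abs_nonneg (x1 p)]⟩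
  have hE : 1 < ((e : R k) : ℝ × ℝ).1 := he.1
  set E := ((e : R k) : ℝ × ℝ).1 with hEdef
  have hE2 : 1 < E ^ 2 := by nlinarith
  set L := E ^ 2 + |μ| with hL
  have hL1 : 1 ≤ L := by linarith [abs_nonneg μ]
  set W := L + L / δ + L / δ * M with hW
  refine ⟨{q | δ < y1 q ∧ δ < y2 q ∧ |x1 q| < M ∧ |x2 q| < M}, ?_,
    {c : R k | |(c : ℝ × ℝ).1| ≤ W ∧ |(c : ℝ × ℝ).2| ≤ W} ×ˢ
    {c : R k | |(c : ℝ × ℝ).1| ≤ W ∧ |(c : ℝ × ℝ).2| ≤ W},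
    (finite_box hk1 W).prod (finite_box hk1 W), ?_⟩
  · refine IsOpen.mem_nhds ?_ ?_
    swap
    · exact ⟨hδ1, hδ2, hM1, hM2⟩
    unfold y1 y2 x1 x2
    apply IsOpen.and (isOpen_lt (by fun_prop) (by fun_prop))
    apply IsOpen.and (isOpen_lt (by fun_prop) (by fun_prop))
    apply IsOpen.and (isOpen_lt (by fun_prop) (by fun_prop)) (isOpen_lt (by fun_prop) (by fun_prop))
  · rintro q ⟨hq1, hq2, hq3, hq4⟩
    refine ⟨⟨hδ.trans hq1, hδ.trans hq2⟩, ?_⟩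
    intro c d hcd hμ
    have hA := den_pos (x := x1 q) (hδ.trans hq1)
      (hcd.imp (fun h h' => h (R_inj1 hk hk1 c h')) (fun h h' => h (R_inj1 hk hk1 d h')))
    obtain ⟨n, hn1, hn2⟩ := exists_mem_Ico_zpow hA hE2
    refine ⟨e ^ (-n), ?_⟩
    rw [← HNorm_unit (e ^ (-n))] at hμ
    have hu : ((((e ^ (-n) : (R k)ˣ) : R k) : ℝ × ℝ).1) ^ 2 = ((E ^ 2) ^ n)⁻¹ := by
      rw [unit_zpow1, ← hEdef, zpow_neg, inv_pow, ← zpow_natCast, ← zpow_natCast, zpow_comm]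
    have hpos : 0 < (E ^ 2) ^ n := zpow_pos (by positivity) n
    unfold HNorm at hμ
    set u : R k := ((e ^ (-n) : (R k)ˣ) : R k) with hudef
    have e1 : (((u * c : R k) : ℝ × ℝ).1 * x1 q + ((u * d : R k) : ℝ × ℝ).1) ^ 2
        + ((u * c : R k) : ℝ × ℝ).1 ^ 2 * y1 q ^ 2 = ((E ^ 2) ^ n)⁻¹ *
        (((c : ℝ × ℝ).1 * x1 q + (d : ℝ × ℝ).1) ^ 2 + (c : ℝ × ℝ).1 ^ 2 * y1 q ^ 2) := by
      rw [← hu]; simp only [Subring.coe_mul, Prod.fst_mul]; ring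
    have b1 : 1 ≤ ((E ^ 2) ^ n)⁻¹ *
        (((c : ℝ × ℝ).1 * x1 q + (d : ℝ × ℝ).1) ^ 2 + (c : ℝ × ℝ).1 ^ 2 * y1 q ^ 2) := by
      rw [← div_eq_inv_mul, le_div_iff₀ hpos]; linarith
    have b2 : ((E ^ 2) ^ n)⁻¹ *
        (((c : ℝ × ℝ).1 * x1 q + (d : ℝ × ℝ).1) ^ 2 + (c : ℝ × ℝ).1 ^ 2 * y1 q ^ 2) ≤ E ^ 2 := by
      rw [← div_eq_inv_mul, div_le_iff₀ hpos]
      rw [zpow_add₀ (by positivity), zpow_one] at hn2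
      linarith
    rw [← e1] at b1 b2
    have b3 : (((u * c : R k) : ℝ × ℝ).2 * x2 q + ((u * d : R k) : ℝ × ℝ).2) ^ 2
        + ((u * c : R k) : ℝ × ℝ).2 ^ 2 * y2 q ^ 2 ≤ L := by
      have h0 : 0 ≤ (((u * c : R k) : ℝ × ℝ).2 * x2 q + ((u * d : R k) : ℝ × ℝ).2) ^ 2
        + ((u * c : R k) : ℝ × ℝ).2 ^ 2 * y2 q ^ 2 := by positivity
      nlinarith [le_abs_self μ]
    have c1 := bound1 hδ hq1 hq3 hL1 (b2.trans (by linarith [abs_nonneg μ]))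
    have c2 := bound1 hδ hq2 hq4 hL1 b3
    exact ⟨⟨c1.1, c2.1⟩, ⟨c1.2, c2.2⟩⟩

lemma moeb_quad {a b c d x y : ℝ} (hdet : a * d - b * c = 1)
    (hD : 0 < (c * x + d) ^ 2 + c ^ 2 * y ^ 2) (P Q C D : ℝ) :
    (P * (moeb a b c d x y).1 + Q) * (C * (moeb a b c d x y).1 + D)
      + P * C * (moeb a b c d x y).2 ^ 2 =
    (((P * a + Q * c) * x + (P * b + Q * d)) * ((C * a + D * c) * x + (C * b + D * d)) +
      (P * a + Q * c) * (C * a + D * c) * y ^ 2) / ((c * x + d) ^ 2 + c ^ 2 * y ^ 2) := by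
  have hN : (moeb a b c d x y).1 ^ 2 + (moeb a b c d x y).2 ^ 2 =
      ((a * x + b) ^ 2 + a ^ 2 * y ^ 2) / ((c * x + d) ^ 2 + c ^ 2 * y ^ 2) := by
    simp only [moeb]
    rw [div_pow, div_pow, ← add_div, div_eq_div_iff (by positivity) (by positivity)]
    have : y ^ 2 = y ^ 2 * (a * d - b * c) ^ 2 := by rw [hdet]; ring
    rw [show ((a * x + b) * (c * x + d) + a * c * y ^ 2) ^ 2 + y ^ 2 =
      ((a * x + b) * (c * x + d) + a * c * y ^ 2) ^ 2 + y ^ 2 * (a * d - b * c) ^ 2 by rw [← this]]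
    ring
  have hX : (moeb a b c d x y).1 = ((a * x + b) * (c * x + d) + a * c * y ^ 2) /
      ((c * x + d) ^ 2 + c ^ 2 * y ^ 2) := rfl
  have : (P * (moeb a b c d x y).1 + Q) * (C * (moeb a b c d x y).1 + D)
      + P * C * (moeb a b c d x y).2 ^ 2 = P * C * ((moeb a b c d x y).1 ^ 2 +
      (moeb a b c d x y).2 ^ 2) + (P * D + Q * C) * (moeb a b c d x y).1 + Q * D := by ring
  rw [this, hN, hX, eq_div_iff hD.ne', add_mul, add_mul, mul_assoc (P * C), mul_assoc (P * D + Q * C),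
    div_mul_cancel₀ _ hD.ne', div_mul_cancel₀ _ hD.ne']
  ring

lemma moeb_den {a b c d x y : ℝ} (hdet : a * d - b * c = 1)
    (hD : 0 < (c * x + d) ^ 2 + c ^ 2 * y ^ 2) (C D : ℝ) :
    (C * (moeb a b c d x y).1 + D) ^ 2 + C ^ 2 * (moeb a b c d x y).2 ^ 2 =
    (((C * a + D * c) * x + (C * b + D * d)) ^ 2 +
      (C * a + D * c) ^ 2 * y ^ 2) / ((c * x + d) ^ 2 + c ^ 2 * y ^ 2) := by
  have := moeb_quad hdet hD C D C D
  rw [← pow_two, ← pow_two, ← pow_two, ← pow_two] at this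
  exact this

lemma moeb_mul {a b c d x y : ℝ} (hdet : a * d - b * c = 1)
    (hD : 0 < (c * x + d) ^ 2 + c ^ 2 * y ^ 2) (P Q C D : ℝ) :
    moeb P Q C D (moeb a b c d x y).1 (moeb a b c d x y).2 =
      moeb (P * a + Q * c) (P * b + Q * d) (C * a + D * c) (C * b + D * d) x y := by
  rw [moeb, moeb_quad hdet hD, moeb_den hdet hD, div_div_div_cancel_right₀ hD.ne']
  refine Prod.ext rfl ?_
  simp only [moeb]
  rw [div_div_div_cancel_right₀ hD.ne']

lemma det1 {k : ℕ} (g : SL k) : (g.1 0 0 : ℝ × ℝ).1 * (g.1 1 1 : ℝ × ℝ).1 -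
    (g.1 0 1 : ℝ × ℝ).1 * (g.1 1 0 : ℝ × ℝ).1 = 1 := by
  have h := g.2
  rw [Matrix.det_fin_two] at h
  exact congrArg (fun z : R k => (z : ℝ × ℝ).1) h

lemma det2 {k : ℕ} (g : SL k) : (g.1 0 0 : ℝ × ℝ).2 * (g.1 1 1 : ℝ × ℝ).2 -
    (g.1 0 1 : ℝ × ℝ).2 * (g.1 1 0 : ℝ × ℝ).2 = 1 := by
  have h := g.2
  rw [Matrix.det_fin_two] at h
  exact congrArg (fun z : R k => (z : ℝ × ℝ).2) h

lemma row_ne {a b c d : ℝ} (h : a * d - b * c = 1) : c ≠ 0 ∨ d ≠ 0 := by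
  by_contra hh
  push Not at hh
  rw [hh.1, hh.2] at h
  simp at h

lemma dpos1 {k : ℕ} (g : SL k) {p : Pt} (hp : p ∈ HH) :
    0 < ((g.1 1 0 : ℝ × ℝ).1 * x1 p + (g.1 1 1 : ℝ × ℝ).1) ^ 2 +
      (g.1 1 0 : ℝ × ℝ).1 ^ 2 * y1 p ^ 2 := den_pos hp.1 (row_ne (det1 g))

lemma dpos2 {k : ℕ} (g : SL k) {p : Pt} (hp : p ∈ HH) :
    0 < ((g.1 1 0 : ℝ × ℝ).2 * x2 p + (g.1 1 1 : ℝ × ℝ).2) ^ 2 +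
      (g.1 1 0 : ℝ × ℝ).2 ^ 2 * y2 p ^ 2 := den_pos hp.2 (row_ne (det2 g))

lemma act_HH {k : ℕ} (g : SL k) {p : Pt} (hp : p ∈ HH) : act k g p ∈ HH :=
  ⟨div_pos hp.1 (dpos1 g hp), div_pos hp.2 (dpos2 g hp)⟩

lemma act_mul {k : ℕ} (g h : SL k) {p : Pt} (hp : p ∈ HH) :
    act k g (act k h p) = act k (g * h) p := by
  have m1 := moeb_mul (det1 h) (dpos1 h hp) (g.1 0 0 : ℝ × ℝ).1 (g.1 0 1 : ℝ × ℝ).1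
    (g.1 1 0 : ℝ × ℝ).1 (g.1 1 1 : ℝ × ℝ).1
  have m2 := moeb_mul (det2 h) (dpos2 h hp) (g.1 0 0 : ℝ × ℝ).2 (g.1 0 1 : ℝ × ℝ).2
    (g.1 1 0 : ℝ × ℝ).2 (g.1 1 1 : ℝ × ℝ).2
  have e : ∀ i j, (g * h).1 i j = g.1 i 0 * h.1 0 j + g.1 i 1 * h.1 1 j := by
    intro i j
    have : (g * h).1 = g.1 * h.1 := rfl
    rw [this, Matrix.mul_apply, Fin.sum_univ_two]
  unfold act
  simp only [e, Subring.coe_add, Subring.coe_mul, Prod.fst_add, Prod.fst_mul, Prod.snd_add,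
    Prod.snd_mul, ← m1, ← m2]
  rfl

lemma act_one {k : ℕ} (p : Pt) : act k 1 p = p := by
  simp [act, moeb, x1, x2, y1, y2]

lemma HNorm_act {k : ℕ} (g : SL k) {p : Pt} (hp : p ∈ HH) (C D : R k) :
    HNorm (C : ℝ × ℝ) (D : ℝ × ℝ) (act k g p) * HNorm (g.1 1 0 : ℝ × ℝ) (g.1 1 1 : ℝ × ℝ) p =
    HNorm ((C * g.1 0 0 + D * g.1 1 0 : R k) : ℝ × ℝ)
      ((C * g.1 0 1 + D * g.1 1 1 : R k) : ℝ × ℝ) p := by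
  have d1 := dpos1 g hp
  have d2 := dpos2 g hp
  have m1 := moeb_den (det1 g) d1 (C : ℝ × ℝ).1 (D : ℝ × ℝ).1
  have m2 := moeb_den (det2 g) d2 (C : ℝ × ℝ).2 (D : ℝ × ℝ).2
  rw [eq_div_iff d1.ne'] at m1
  rw [eq_div_iff d2.ne'] at m2
  simp only [HNorm, Subring.coe_add, Subring.coe_mul, Prod.fst_add, Prod.fst_mul, Prod.snd_add,
    Prod.snd_mul]
  rw [← m1, ← m2, mul_mul_mul_comm]
  rfl

lemma HNorm_pos {k : ℕ} (g : SL k) {p : Pt} (hp : p ∈ HH) :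
    0 < HNorm (g.1 1 0 : ℝ × ℝ) (g.1 1 1 : ℝ × ℝ) p := mul_pos (dpos1 g hp) (dpos2 g hp)

lemma Spairs_iff {k : ℕ} (c d : R k) : (c, d) ∈ Spairs k ↔ ∃ a b : R k, a * d - b * c = 1 := by
  simp only [Spairs, Set.mem_ofPred_eq]
  rw [Ideal.eq_top_iff_one, Ideal.mem_span_pair]
  constructor
  · rintro ⟨a, b, h⟩; exact ⟨b, -a, by rw [← h]; ring⟩
  · rintro ⟨a, b, h⟩; exact ⟨-b, a, by rw [← h]; ring⟩

lemma Spairs_mul {k : ℕ} (g : SL k) (C D : R k) (h : (C, D) ∈ Spairs k) :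
    (C * g.1 0 0 + D * g.1 1 0, C * g.1 0 1 + D * g.1 1 1) ∈ Spairs k := by
  rw [Spairs_iff] at *
  obtain ⟨a, b, h⟩ := h
  have hg := g.2
  rw [Matrix.det_fin_two] at hg
  refine ⟨a * g.1 0 0 + b * g.1 1 0, a * g.1 0 1 + b * g.1 1 1, ?_⟩
  linear_combination h * (g.1 0 0 * g.1 1 1 - g.1 0 1 * g.1 1 0) + hg

lemma Spairs_unit {k : ℕ} (u : (R k)ˣ) (C D : R k) (h : (C, D) ∈ Spairs k) :
    ((u : R k) * C, (u : R k) * D) ∈ Spairs k := by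
  rw [Spairs_iff] at *
  obtain ⟨a, b, h⟩ := h
  refine ⟨a * (u⁻¹ : (R k)ˣ), b * (u⁻¹ : (R k)ˣ), ?_⟩
  have := Units.mul_inv u
  linear_combination h + (a * D - b * C) * this

lemma Spairs_ne {k : ℕ} {c d : R k} (h : (c, d) ∈ Spairs k) : c ≠ 0 ∨ d ≠ 0 := by
  rw [Spairs_iff] at h
  obtain ⟨a, b, h⟩ := h
  by_contra hh
  push Not at hh
  rw [hh.1, hh.2] at h
  simp at h

lemma HNorm_zero {k : ℕ} (u : (R k)ˣ) (p : Pt) :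
    HNorm ((0 : R k) : ℝ × ℝ) ((u : R k) : ℝ × ℝ) p = 1 := by
  have h := unit_norm u
  simp [HNorm]; exact h

lemma Spairs_zero {k : ℕ} {d : R k} (h : ((0 : R k), d) ∈ Spairs k) :
    ∃ u : (R k)ˣ, (u : R k) = d := by
  rw [Spairs_iff] at h
  obtain ⟨a, b, h⟩ := h
  exact ⟨⟨d, a, by linear_combination h, by linear_combination h⟩, rfl⟩

lemma row_Spairs {k : ℕ} (g : SL k) : (g.1 1 0, g.1 1 1) ∈ Spairs k := by
  rw [Spairs_iff]
  have hg := g.2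
  rw [Matrix.det_fin_two] at hg
  exact ⟨_, _, hg⟩

lemma F0_act {k : ℕ} (g : SL k) {p : Pt} (hp : p ∈ HH)
    (h : ∀ cd ∈ Spairs k, HNorm (g.1 1 0 : ℝ × ℝ) (g.1 1 1 : ℝ × ℝ) p ≤
      HNorm (cd.1 : ℝ × ℝ) (cd.2 : ℝ × ℝ) p) : act k g p ∈ F0 k := by
  refine ⟨act_HH g hp, ?_⟩
  rintro ⟨C, D⟩ hCD
  have h1 := h _ (Spairs_mul g C D hCD)
  simp only at h1 ⊢
  rw [← HNorm_act g hp] at h1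
  have := HNorm_pos g hp
  by_contra hlt
  push Not at hlt
  nlinarith

lemma F0_act' {k : ℕ} (g : SL k) {p : Pt} (hp : p ∈ F0 k) (hg : g.1 1 0 = 0) :
    act k g p ∈ F0 k := by
  apply F0_act g hp.1
  intro cd hcd
  have hr := row_Spairs g
  rw [hg] at hr ⊢
  obtain ⟨u, hu⟩ := Spairs_zero hr
  rw [← hu, HNorm_zero]
  exact hp.2 cd hcd

lemma exists_F0 {k : ℕ} (hk : Squarefree k) (hk1 : 1 < k) (e : (R k)ˣ) (he : IsFundUnit k e)
    (p : Pt) (hp : p ∈ HH) : ∃ g : SL k, act k g p ∈ F0 k := by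
  obtain ⟨U, hU, T, hT, h⟩ := loc_fin hk hk1 e he p hp 1
  obtain ⟨-, h⟩ := h p (mem_of_mem_nhds hU)
  have h01 : ((0 : R k), (1 : R k)) ∈ Spairs k := (Spairs_iff _ _).2 ⟨1, 0, by ring⟩
  have hn01 := HNorm_zero (1 : (R k)ˣ) p
  rw [Units.val_one] at hn01
  obtain ⟨⟨c, d⟩, ⟨hcT, hcS⟩, hmin⟩ := Set.exists_min_image (T ∩ Spairs k)
    (fun cd => HNorm (cd.1 : ℝ × ℝ) (cd.2 : ℝ × ℝ) p) (hT.subset Set.inter_subset_left) (by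
      obtain ⟨u, hu⟩ := h 0 1 (Spairs_ne h01) hn01.le
      exact ⟨_, hu, Spairs_unit u _ _ h01⟩)
  have key : ∀ cd ∈ Spairs k, HNorm (cd.1 : ℝ × ℝ) (cd.2 : ℝ × ℝ) p ≤ 1 →
      HNorm (c : ℝ × ℝ) (d : ℝ × ℝ) p ≤ HNorm (cd.1 : ℝ × ℝ) (cd.2 : ℝ × ℝ) p := by
    rintro ⟨c', d'⟩ hcd hle
    obtain ⟨u, hu⟩ := h c' d' (Spairs_ne hcd) hle
    have := hmin _ ⟨hu, Spairs_unit u _ _ hcd⟩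
    simpa only [HNorm_unit] using this
  obtain ⟨a, b, hab⟩ := (Spairs_iff _ _).1 hcS
  refine ⟨⟨!![a, b; c, d], by rw [Matrix.det_fin_two_of]; exact hab⟩, ?_⟩
  apply F0_act _ hp
  intro cd hcd
  have : HNorm (c : ℝ × ℝ) (d : ℝ × ℝ) p ≤ HNorm (cd.1 : ℝ × ℝ) (cd.2 : ℝ × ℝ) p := by
    rcases le_total (HNorm (cd.1 : ℝ × ℝ) (cd.2 : ℝ × ℝ) p) 1 with h1 | h1
    · exact key cd hcd h1
    · exact (key _ h01 hn01.le).trans (hn01.le.trans h1)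
  simpa using this

lemma s1_shift {k : ℕ} (hk1 : 1 < k) (p q : Pt) (m n : ℝ) (h1 : x1 q = x1 p + (m + n * omg k))
    (h2 : x2 q = x2 p + (m + n * omg' k)) : s1 k q = s1 k p + m := by
  have := omg_sub_pos hk1
  have h0 : omg' k - omg k ≠ 0 := by linarith
  unfold s1; rw [h1, h2]; field_simp; ring

lemma s2_shift {k : ℕ} (hk1 : 1 < k) (p q : Pt) (m n : ℝ) (h1 : x1 q = x1 p + (m + n * omg k))
    (h2 : x2 q = x2 p + (m + n * omg' k)) : s2 k q = s2 k p + n := by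
  have := omg_sub_pos hk1
  unfold s2; rw [h1, h2]; field_simp; ring

lemma rr_act {k : ℕ} (g : SL k) (hg : g.1 1 0 = 0) (p : Pt) :
    rr (act k g p) = rr p / (g.1 1 1 : ℝ × ℝ).1 ^ 4 ∧ (g.1 1 1 : ℝ × ℝ).1 ≠ 0 := by
  have hr := row_Spairs g
  rw [hg] at hr
  obtain ⟨u, hu⟩ := Spairs_zero hr
  have hn := unit_norm u
  rw [hu] at hn
  have h1 : (g.1 1 1 : ℝ × ℝ).1 ≠ 0 := by intro h; rw [h] at hn; simp at hn
  have h2 : (g.1 1 1 : ℝ × ℝ).2 ≠ 0 := by intro h; rw [h] at hn; simp at hn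
  refine ⟨?_, h1⟩
  have a1 : y1 (act k g p) = y1 p / (g.1 1 1 : ℝ × ℝ).1 ^ 2 := by
    simp [act, y1, moeb, hg]
  have a2 : y2 (act k g p) = y2 p / (g.1 1 1 : ℝ × ℝ).2 ^ 2 := by
    simp [act, y2, moeb, hg]
  unfold rr
  rw [a1, a2]
  have h3 : (g.1 1 1 : ℝ × ℝ).2 ^ 2 = 1 / (g.1 1 1 : ℝ × ℝ).1 ^ 2 := by
    field_simp; linarith
  rw [h3]
  field_simp

lemma covering {k : ℕ} (hk : Squarefree k) (hk1 : 1 < k) (e : (R k)ˣ) (he : IsFundUnit k e)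
    (p : Pt) (hp : p ∈ HH) : ∃ g : SL k, act k g p ∈ F k (eps k e) := by
  obtain ⟨g, hg⟩ := exists_F0 hk hk1 e he p hp
  set q := act k g p with hq
  have hE : 1 < ((e : R k) : ℝ × ℝ).1 := he.1
  set E := ((e : R k) : ℝ × ℝ).1 with hEdef
  have hE0 : 0 < E := by linarith
  have hr : 0 < rr q := div_pos hg.1.1 hg.1.2
  obtain ⟨n, hn1, hn2⟩ := exists_mem_Ico_zpow (mul_pos hr (pow_pos hE0 2))
    (one_lt_pow₀ hE (by norm_num : 4 ≠ 0))
  let h1 : SL k := ⟨!![((e ^ (-n) : (R k)ˣ) : R k), 0; 0, ((e ^ n : (R k)ˣ) : R k)], by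
    rw [Matrix.det_fin_two_of, ← Units.val_mul, ← zpow_add]; simp⟩
  have h10 : h1.1 1 0 = 0 := rfl
  have h11 : (h1.1 1 1 : ℝ × ℝ).1 = E ^ n := unit_zpow1 e n
  have hq1 := F0_act' h1 hg h10
  have hr1 := (rr_act h1 h10 q).1
  set q1 := act k h1 q with hq1def
  have hpw : (E ^ n) ^ 4 = (E ^ 4) ^ n := by
    rw [← zpow_natCast, ← zpow_natCast, zpow_comm]
  rw [h11, hpw] at hr1
  have hpos : 0 < (E ^ 4) ^ n := zpow_pos (by positivity) n
  let h2 : SL k := ⟨!![1, ofInt k (-round (s1 k q1)) (-round (s2 k q1)); 0, 1], by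
    rw [Matrix.det_fin_two_of]; simp⟩
  have h20 : h2.1 1 0 = 0 := rfl
  have h21 : h2.1 1 1 = 1 := rfl
  have h22 : h2.1 0 0 = 1 := rfl
  have h23 : h2.1 0 1 = ofInt k (-round (s1 k q1)) (-round (s2 k q1)) := rfl
  have hq2 := F0_act' h2 hq1 h20
  have hr2 := (rr_act h2 h20 q1).1
  rw [h21] at hr2
  have hx1 : x1 (act k h2 q1) = x1 q1 + (((-round (s1 k q1) : ℤ) : ℝ) +
      ((-round (s2 k q1) : ℤ) : ℝ) * omg k) := by
    rw [← ofInt_1, ← h23]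
    simp [act, moeb, h20, h21, h22]
    rfl
  have hx2 : x2 (act k h2 q1) = x2 q1 + (((-round (s1 k q1) : ℤ) : ℝ) +
      ((-round (s2 k q1) : ℤ) : ℝ) * omg' k) := by
    rw [← ofInt_2, ← h23]
    simp [act, moeb, h20, h21, h22]
    rfl
  refine ⟨h2 * (h1 * g), ?_⟩
  rw [← act_mul _ _ hp, ← act_mul _ _ hp, ← hq, ← hq1def]
  refine ⟨⟨hq2.1, ?_, ?_, ?_, ?_⟩, hq2⟩
  · rw [s1_shift hk1 _ _ _ _ hx1 hx2]
    have := abs_sub_round (s1 k q1)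
    push_cast; rwa [← sub_eq_add_neg]
  · rw [s2_shift hk1 _ _ _ _ hx1 hx2]
    have := abs_sub_round (s2 k q1)
    push_cast; rwa [← sub_eq_add_neg]
  · rw [hr2, hr1]
    change (E ^ 2)⁻¹ ≤ _
    simp
    rw [le_div_iff₀ hpos, inv_mul_le_iff₀ (by positivity)]
    linarith
  · rw [hr2, hr1]
    change _ ≤ E ^ 2
    simp
    rw [div_le_iff₀ hpos]
    rw [zpow_add₀ (by positivity), zpow_one] at hn2
    have : 0 < E ^ 2 := by positivity
    nlinarith

lemma interior_curve {S : Set Pt} {p : Pt} (hp : p ∈ interior S) (f : ℝ → Pt) (hf : Continuous f)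
    (h0 : f 0 = p) : ∃ t : ℝ, 0 < t ∧ t < 1 ∧ f t ∈ S ∧ f (-t) ∈ S := by
  have h1 : f ⁻¹' S ∈ nhds (0 : ℝ) :=
    hf.continuousAt.preimage_mem_nhds (by rw [h0]; exact mem_interior_iff_mem_nhds.1 hp)
  obtain ⟨δ, hδ, hb⟩ := Metric.mem_nhds_iff.1 h1
  have hm : 0 < min δ 1 := lt_min hδ one_pos
  refine ⟨min δ 1 / 2, by positivity, by linarith [min_le_right δ 1], hb ?_, hb ?_⟩
  · rw [Metric.mem_ball, dist_zero_right, Real.norm_eq_abs, abs_of_pos (by positivity)]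
    linarith [min_le_left δ 1]
  · rw [Metric.mem_ball, dist_zero_right, Real.norm_eq_abs, abs_neg, abs_of_pos (by positivity)]
    linarith [min_le_left δ 1]

lemma int_strict {k : ℕ} (hk : Squarefree k) (hk1 : 1 < k) {ε : ℝ} {p : Pt}
    (hp : p ∈ interior (F k ε)) : |s1 k p| < 1 / 2 ∧ |s2 k p| < 1 / 2 ∧ (ε ^ 2)⁻¹ < rr p ∧
      rr p < ε ^ 2 ∧ ∀ cd ∈ Spairs k, cd.1 ≠ 0 → 1 < HNorm (cd.1 : ℝ × ℝ) (cd.2 : ℝ × ℝ) p := by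
  have hpH : p ∈ HH := (interior_subset hp).1.1
  have hr : 0 < rr p := div_pos hpH.1 hpH.2
  obtain ⟨t, ht, ht1, ⟨⟨-, -, -, -, a1⟩, -⟩, ⟨⟨-, -, -, a2, -⟩, a3⟩⟩ := interior_curve hp
    (fun t => (x1 p, x2 p, y1 p * (1 + t), y2 p)) (by fun_prop) (by simp [x1, x2, y1, y2])
  have hrr : ∀ t, rr (x1 p, x2 p, y1 p * (1 + t), y2 p) = rr p * (1 + t) := by
    intro t; simp only [rr, y1, y2]; ring
  rw [hrr] at a1 a2
  refine ⟨?_, ?_, by nlinarith, by nlinarith, ?_⟩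
  · obtain ⟨t, ht, -, ⟨⟨-, a, -⟩, -⟩, ⟨⟨-, b, -⟩, -⟩⟩ := interior_curve hp
      (fun t => (x1 p + t, x2 p + t, y1 p, y2 p)) (by fun_prop) (by simp [x1, x2, y1, y2])
    rw [s1_shift hk1 p _ t 0 (by simp [x1]) (by simp [x2])] at a
    rw [s1_shift hk1 p _ (-t) 0 (by simp [x1]) (by simp [x2])] at b
    rw [abs_le] at a b
    rw [abs_lt]; constructor <;> linarith
  · obtain ⟨t, ht, -, ⟨⟨-, -, a, -⟩, -⟩, ⟨⟨-, -, b, -⟩, -⟩⟩ := interior_curve hp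
      (fun t => (x1 p + t * omg k, x2 p + t * omg' k, y1 p, y2 p)) (by fun_prop)
      (by simp [x1, x2, y1, y2])
    rw [s2_shift hk1 p _ 0 t (by simp [x1]) (by simp [x2])] at a
    rw [s2_shift hk1 p _ 0 (-t) (by simp [x1]) (by simp [x2])] at b
    rw [abs_le] at a b
    rw [abs_lt]; constructor <;> linarith
  · rintro ⟨c, d⟩ hcd hc
    have h1 := a3.2 _ hcd
    refine h1.trans_lt ?_
    simp only at hc ⊢
    have hc1 : (c : ℝ × ℝ).1 ≠ 0 := fun h => hc (R_inj1 hk hk1 c h)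
    have hc2 : (c : ℝ × ℝ).2 ≠ 0 := fun h => hc (R_inj2 hk hk1 c h)
    have hB : 0 < ((c : ℝ × ℝ).2 * x2 p + (d : ℝ × ℝ).2) ^ 2 + (c : ℝ × ℝ).2 ^ 2 * y2 p ^ 2 :=
      den_pos hpH.2 (Or.inl hc2)
    have hy : (y1 p * (1 + -t)) ^ 2 < y1 p ^ 2 := by
      have := hpH.1
      apply pow_lt_pow_left₀ _ _ (by norm_num) <;> nlinarith
    have hc3 : 0 < (c : ℝ × ℝ).1 ^ 2 := by positivity
    have hA : ((c : ℝ × ℝ).1 * x1 p + (d : ℝ × ℝ).1) ^ 2 +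
        (c : ℝ × ℝ).1 ^ 2 * (y1 p * (1 + -t)) ^ 2 < ((c : ℝ × ℝ).1 * x1 p + (d : ℝ × ℝ).1) ^ 2 +
        (c : ℝ × ℝ).1 ^ 2 * y1 p ^ 2 := by
      nlinarith
    exact mul_lt_mul_of_pos_right hA hB

lemma unit_small {k : ℕ} (e : (R k)ˣ) (he : IsFundUnit k e)
    (u : (R k)ˣ) (h1 : ((u : R k) : ℝ × ℝ).1 ^ 4 < eps k e ^ 4)
    (h2 : 1 < eps k e ^ 4 * ((u : R k) : ℝ × ℝ).1 ^ 4) : ((u : R k) : ℝ × ℝ).1 ^ 2 = 1 := by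
  have hE : 1 < eps k e := he.1
  have key : ∀ v : (R k)ˣ, ((v : R k) : ℝ × ℝ).1 ^ 4 < eps k e ^ 4 →
      |((v : R k) : ℝ × ℝ).1| ≤ 1 := by
    intro v hv
    by_contra hlt
    push Not at hlt
    have hge : eps k e ≤ |((v : R k) : ℝ × ℝ).1| := by
      rcases abs_choice (((v : R k) : ℝ × ℝ).1) with h | h
      · rw [h] at hlt ⊢; exact he.2 v hlt
      · rw [h] at hlt ⊢; exact he.2 (-v) hlt
    have h4 := pow_le_pow_left₀ (by linarith) hge 4
    rw [Even.pow_abs (by decide)] at h4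
    linarith
  have k1 := key u h1
  have hm := unit_mul1 u
  have k2 := key u⁻¹ (by
    have h3 : ((u : R k) : ℝ × ℝ).1 ^ 4 * (((u⁻¹ : (R k)ˣ) : R k) : ℝ × ℝ).1 ^ 4 = 1 := by
      rw [← mul_pow, hm, one_pow]
    have h5 : ((u : R k) : ℝ × ℝ).1 ≠ 0 := by intro h; rw [h] at hm; simp at hm
    have h6 : 0 < ((u : R k) : ℝ × ℝ).1 ^ 4 := by positivity
    by_contra hh
    push Not at hh
    nlinarith)
  have hm' : |((u : R k) : ℝ × ℝ).1| * |(((u⁻¹ : (R k)ˣ) : R k) : ℝ × ℝ).1| = 1 := by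
    rw [← abs_mul, hm, abs_one]
  have : |((u : R k) : ℝ × ℝ).1| = 1 := by
    nlinarith [abs_nonneg ((u : R k) : ℝ × ℝ).1]
  rw [← sq_abs, this, one_pow]

lemma disjointness {k : ℕ} (hk : Squarefree k) (hk1 : 1 < k) (e : (R k)ˣ) (he : IsFundUnit k e)
    (g : SL k) (p : Pt) (hp : p ∈ interior (F k (eps k e)))
    (hq : act k g p ∈ interior (F k (eps k e))) : g = 1 ∨ g.1 = -1 := by
  have hpH : p ∈ HH := (interior_subset hp).1.1
  obtain ⟨ps1, ps2, pr1, pr2, pS⟩ := int_strict hk hk1 hp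
  obtain ⟨qs1, qs2, qr1, qr2, qS⟩ := int_strict hk hk1 hq
  have hdet := g.2
  rw [Matrix.det_fin_two] at hdet
  have hg : g.1 1 0 = 0 := by
    by_contra hc
    have h1 := pS _ (row_Spairs g) hc
    have h2 := qS (-g.1 1 0, g.1 0 0) ((Spairs_iff _ _).2 ⟨g.1 1 1, -g.1 0 1, by
      linear_combination hdet⟩ ) (neg_ne_zero.2 hc)
    have h3 := HNorm_act g hpH (-g.1 1 0) (g.1 0 0)
    rw [show -g.1 1 0 * g.1 0 0 + g.1 0 0 * g.1 1 0 = 0 by ring,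
      show -g.1 1 0 * g.1 0 1 + g.1 0 0 * g.1 1 1 = ((1 : (R k)ˣ) : R k) by
        rw [Units.val_one]; linear_combination hdet, HNorm_zero] at h3
    simp only at h1 h2
    nlinarith
  have hE : 1 < eps k e := he.1
  have hE0 : 0 < eps k e := by linarith
  obtain ⟨hr, hd0⟩ := rr_act g hg p
  have hrow := row_Spairs g
  rw [hg] at hrow
  obtain ⟨u, hu⟩ := Spairs_zero hrow
  have hd4 : 0 < (g.1 1 1 : ℝ × ℝ).1 ^ 4 := by positivity
  have hrp : 0 < rr p := div_pos hpH.1 hpH.2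
  rw [hr] at qr1 qr2
  have hE2 : 0 < eps k e ^ 2 := by positivity
  rw [lt_div_iff₀ hd4, inv_mul_lt_iff₀ hE2] at qr1
  rw [div_lt_iff₀ hd4] at qr2
  rw [inv_lt_iff_one_lt_mul₀ hE2] at pr1
  have hsq : (g.1 1 1 : ℝ × ℝ).1 ^ 2 = 1 := by
    rw [← hu]
    apply unit_small e he <;> rw [hu]
    · nlinarith
    · nlinarith
  rw [hg, mul_zero, sub_zero] at hdet
  have hd : g.1 1 1 = 1 ∨ g.1 1 1 = -1 := by
    rcases sq_eq_sq_iff_eq_or_eq_neg.1 (hsq.trans (one_pow 2).symm) with h | h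
    · left
      rw [← sub_eq_zero]
      exact R_inj1 hk hk1 _ (by simp [h])
    · right
      rw [← sub_eq_zero]
      exact R_inj1 hk hk1 _ (by simp [h])
  have hb : g.1 0 1 = 0 := by
    obtain ⟨m, n, hmn⟩ := exists_ofInt (g.1 0 1 * g.1 1 1)
    have hx1 : x1 (act k g p) = x1 p + (m + n * omg k) := by
      rw [← ofInt_1, ← hmn]
      rcases hd with h | h
      · rw [h, mul_one] at hdet
        simp [act, moeb, hg, h, hdet, x1]
      · have h' : g.1 0 0 = -1 := by rw [h] at hdet; linear_combination -hdet
        simp [act, moeb, hg, h, h', x1, add_comm]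
    have hx2 : x2 (act k g p) = x2 p + (m + n * omg' k) := by
      rw [← ofInt_2, ← hmn]
      rcases hd with h | h
      · rw [h, mul_one] at hdet
        simp [act, moeb, hg, h, hdet, x2]
      · have h' : g.1 0 0 = -1 := by rw [h] at hdet; linear_combination -hdet
        simp [act, moeb, hg, h, h', x2, add_comm]
    rw [s1_shift hk1 _ _ _ _ hx1 hx2] at qs1
    rw [s2_shift hk1 _ _ _ _ hx1 hx2] at qs2
    rw [abs_lt] at ps1 ps2 qs1 qs2
    have small : ∀ j : ℤ, (-1 : ℝ) < j → (j : ℝ) < 1 → j = 0 := by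
      intro j h1 h2
      have h1' : -1 < j := by exact_mod_cast h1
      have h2' : j < 1 := by exact_mod_cast h2
      omega
    have hm := small m (by linarith) (by linarith)
    have hn := small n (by linarith) (by linarith)
    subst hm hn
    have h0 : g.1 0 1 * g.1 1 1 = 0 := by rw [hmn]; simp [ofInt]
    rcases hd with h | h
    · simpa [h] using h0
    · simpa [h] using h0
  rcases hd with h | h
  · left
    rw [h, mul_one] at hdet
    apply Subtype.ext
    ext i j : 2
    fin_cases i <;> fin_cases j <;> simp [hg, h, hdet, hb]
  · right
    have h' : g.1 0 0 = -1 := by rw [h] at hdet; linear_combination -hdet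
    ext i j : 2
    fin_cases i <;> fin_cases j <;> simp [hg, h, h', hb]

lemma null_x2 {A : Set Pt} (hA : MeasurableSet A)
    (h : ∀ a c, {b : ℝ | (a, b, c) ∈ A}.Subsingleton) : volume A = 0 := by
  rw [Measure.volume_eq_prod, Measure.measure_prod_null hA]
  refine Filter.Eventually.of_forall fun a => ?_
  have hB : MeasurableSet (Prod.mk a ⁻¹' A) := measurable_prodMk_left hA
  have hsw := (Measure.measurePreserving_swap (μ := (volume : Measure (ℝ × ℝ)))
    (ν := (volume : Measure ℝ))).measure_preimage hB.nullMeasurableSet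
  change volume (Prod.mk a ⁻¹' A) = 0
  rw [Measure.volume_eq_prod, ← hsw, Measure.measure_prod_null (measurable_swap hB)]
  refine Filter.Eventually.of_forall fun c => ?_
  exact (h a c).measure_zero _

lemma null_y2 {A : Set Pt} (hA : MeasurableSet A)
    (h : ∀ a b c, {d : ℝ | (a, b, c, d) ∈ A}.Subsingleton) : volume A = 0 := by
  rw [Measure.volume_eq_prod, Measure.measure_prod_null hA]
  refine Filter.Eventually.of_forall fun a => ?_
  have hB : MeasurableSet (Prod.mk a ⁻¹' A) := measurable_prodMk_left hA
  change volume (Prod.mk a ⁻¹' A) = 0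
  rw [Measure.volume_eq_prod, Measure.measure_prod_null hB]
  refine Filter.Eventually.of_forall fun b => ?_
  have hC : MeasurableSet (Prod.mk b ⁻¹' (Prod.mk a ⁻¹' A)) := measurable_prodMk_left hB
  change volume (Prod.mk b ⁻¹' (Prod.mk a ⁻¹' A)) = 0
  rw [Measure.volume_eq_prod, Measure.measure_prod_null hC]
  refine Filter.Eventually.of_forall fun c => ?_
  exact (h a b c).measure_zero _

lemma R_countable (k : ℕ) : Countable (R k) := by
  apply Function.Surjective.countable (f := fun z : ℤ × ℤ => ofInt k z.1 z.2)
  intro c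
  obtain ⟨a, b, h⟩ := exists_ofInt c
  exact ⟨(a, b), h.symm⟩

lemma cont_s1 (k : ℕ) : Continuous (s1 k) := by unfold s1 x1 x2; fun_prop
lemma cont_s2 (k : ℕ) : Continuous (s2 k) := by unfold s2 x1 x2; fun_prop
lemma cont_y1 : Continuous y1 := by unfold y1; fun_prop
lemma cont_y2 : Continuous y2 := by unfold y2; fun_prop
lemma cont_HNorm (c d : ℝ × ℝ) : Continuous (HNorm c d) := by
  unfold HNorm x1 x2 y1 y2; fun_prop

lemma null_s1 {k : ℕ} (hk1 : 1 < k) (v : ℝ) : volume {p : Pt | s1 k p = v} = 0 := by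
  apply null_x2 (isClosed_eq (cont_s1 k) continuous_const).measurableSet
  intro a c b hb b' hb'
  have h0 := omg_ne hk1
  have h1 : omg' k - omg k ≠ 0 := by linarith [omg_sub_pos hk1]
  have h2 : s1 k (a, b, c) = s1 k (a, b', c) := hb.trans hb'.symm
  simp only [s1, x1, x2] at h2
  rw [div_left_inj' h1] at h2
  exact mul_left_cancel₀ h0 (by linarith)

lemma null_s2 {k : ℕ} (hk1 : 1 < k) (v : ℝ) : volume {p : Pt | s2 k p = v} = 0 := by
  apply null_x2 (isClosed_eq (cont_s2 k) continuous_const).measurableSet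
  intro a c b hb b' hb'
  have h1 := (omg_sub_pos hk1).ne'
  have h2 : s2 k (a, b, c) = s2 k (a, b', c) := hb.trans hb'.symm
  simp only [s2, x1, x2] at h2
  rw [div_left_inj' h1] at h2
  linarith

lemma null_rr {v : ℝ} (hv : v ≠ 0) : volume {p : Pt | y1 p = v * y2 p} = 0 := by
  apply null_y2 (isClosed_eq cont_y1 (continuous_const.mul cont_y2)).measurableSet
  intro a b c d hd d' hd'
  have h : c = v * d := hd
  have h' : c = v * d' := hd'
  exact mul_left_cancel₀ hv (by linarith)

lemma isOpen_HH : IsOpen HH :=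
  IsOpen.and (isOpen_lt continuous_const cont_y1) (isOpen_lt continuous_const cont_y2)

lemma null_HNorm {k : ℕ} (hk : Squarefree k) (hk1 : 1 < k) (c d : R k) (hc : c ≠ 0) :
    volume {p : Pt | p ∈ HH ∧ HNorm (c : ℝ × ℝ) (d : ℝ × ℝ) p = 1} = 0 := by
  have hc1 : (c : ℝ × ℝ).1 ≠ 0 := fun h => hc (R_inj1 hk hk1 c h)
  have hc2 : (c : ℝ × ℝ).2 ≠ 0 := fun h => hc (R_inj2 hk hk1 c h)
  apply null_y2 (isOpen_HH.measurableSet.inter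
    (isClosed_eq (cont_HNorm _ _) continuous_const).measurableSet)
  rintro x x' y z ⟨⟨hy, hz⟩, h⟩ z' ⟨⟨-, hz'⟩, h'⟩
  have hA : 0 < ((c : ℝ × ℝ).1 * x + (d : ℝ × ℝ).1) ^ 2 + (c : ℝ × ℝ).1 ^ 2 * y ^ 2 :=
    den_pos hy (Or.inl hc1)
  simp only [y2] at hz hz'
  have h2 := mul_left_cancel₀ hA.ne' ((show _ = (1 : ℝ) from h).trans (show _ = (1 : ℝ) from h').symm)
  simp only [x2, y2] at h2
  have h3 : z ^ 2 = z' ^ 2 := mul_left_cancel₀ (pow_ne_zero 2 hc2) (by linarith)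
  exact (pow_left_inj₀ hz.le hz'.le (by norm_num)).1 h3

lemma null_frontier {k : ℕ} (hk : Squarefree k) (hk1 : 1 < k) (e : (R k)ˣ) (he : IsFundUnit k e) :
    volume (frontier (F k (eps k e)) ∩ HH) = 0 := by
  have hE : 1 < eps k e := he.1
  set E := eps k e with hEdef
  have hE2 : 0 < E ^ 2 := by positivity
  have := R_countable k
  let N : Set Pt := ({p | s1 k p = 1 / 2} ∪ {p | s1 k p = -(1 / 2)}) ∪
    ({p | s2 k p = 1 / 2} ∪ {p | s2 k p = -(1 / 2)}) ∪
    ({p | y1 p = (E ^ 2)⁻¹ * y2 p} ∪ {p | y1 p = E ^ 2 * y2 p}) ∪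
    ⋃ cd : {cd : R k × R k // cd.1 ≠ 0},
      {p : Pt | p ∈ HH ∧ HNorm (cd.1.1 : ℝ × ℝ) (cd.1.2 : ℝ × ℝ) p = 1}
  have hN : volume N = 0 := by
    refine measure_union_null (measure_union_null (measure_union_null ?_ ?_) ?_) ?_
    · exact measure_union_null (null_s1 hk1 _) (null_s1 hk1 _)
    · exact measure_union_null (null_s2 hk1 _) (null_s2 hk1 _)
    · exact measure_union_null (null_rr (by positivity)) (null_rr (by positivity))
    · exact measure_iUnion_null fun cd => null_HNorm hk hk1 _ _ cd.2
  refine measure_mono_null ?_ hN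
  rintro p ⟨⟨hcl, hni⟩, hpH⟩
  by_contra hpN
  apply hni
  simp only [N, Set.mem_union, Set.mem_ofPred_eq, Set.mem_iUnion, not_or, not_exists] at hpN
  obtain ⟨⟨⟨⟨n1, n2⟩, n3, n4⟩, n5, n6⟩, n7⟩ := hpN
  have rr1 : ∀ q ∈ HH, ((E ^ 2)⁻¹ ≤ rr q ↔ (E ^ 2)⁻¹ * y2 q ≤ y1 q) := fun q hq => by
    unfold rr; rw [le_div_iff₀ hq.2]
  have rr2 : ∀ q ∈ HH, (rr q ≤ E ^ 2 ↔ y1 q ≤ E ^ 2 * y2 q) := fun q hq => by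
    unfold rr; rw [div_le_iff₀ hq.2]
  have cl : ∀ f g : Pt → ℝ, Continuous f → Continuous g → (∀ q ∈ F k E, f q ≤ g q) → f p ≤ g p := by
    intro f g hf hg h
    exact closure_minimal (t := {q | f q ≤ g q}) h (isClosed_le hf hg) hcl
  have b1 := cl _ _ (cont_s1 k).abs (continuous_const (y := (1 / 2 : ℝ))) (fun q hq => hq.1.2.1)
  have b2 := cl _ _ (cont_s2 k).abs (continuous_const (y := (1 / 2 : ℝ))) (fun q hq => hq.1.2.2.1)
  have b3 := cl (fun q => (E ^ 2)⁻¹ * y2 q) y1 (continuous_const.mul cont_y2) cont_y1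
    (fun q hq => (rr1 q hq.1.1).1 hq.1.2.2.2.1)
  have b4 := cl y1 (fun q => E ^ 2 * y2 q) cont_y1 (continuous_const.mul cont_y2)
    (fun q hq => (rr2 q hq.1.1).1 hq.1.2.2.2.2)
  have b5 : ∀ cd ∈ Spairs k, 1 ≤ HNorm (cd.1 : ℝ × ℝ) (cd.2 : ℝ × ℝ) p := fun cd hcd =>
    cl (fun _ => 1) _ continuous_const (cont_HNorm _ _) (fun q hq => hq.2.2 cd hcd)
  have c1 : |s1 k p| < 1 / 2 := lt_of_le_of_ne b1 fun h => by
    rcases (abs_eq (by norm_num)).1 h with h | h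
    · exact n1 h
    · exact n2 h
  have c2 : |s2 k p| < 1 / 2 := lt_of_le_of_ne b2 fun h => by
    rcases (abs_eq (by norm_num)).1 h with h | h
    · exact n3 h
    · exact n4 h
  have c3 : (E ^ 2)⁻¹ * y2 p < y1 p := lt_of_le_of_ne b3 fun h => n5 h.symm
  have c4 : y1 p < E ^ 2 * y2 p := lt_of_le_of_ne b4 n6
  have op : ∀ f g : Pt → ℝ, Continuous f → Continuous g → f p < g p →
      ∀ᶠ q in nhds p, f q < g q := fun f g hf hg h => (isOpen_lt hf hg).mem_nhds h
  have d1 := op _ _ (cont_s1 k).abs (continuous_const (y := (1 / 2 : ℝ))) c1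
  have d2 := op _ _ (cont_s2 k).abs (continuous_const (y := (1 / 2 : ℝ))) c2
  have d3 := op (fun q => (E ^ 2)⁻¹ * y2 q) y1 (continuous_const.mul cont_y2) cont_y1 c3
  have d4 := op y1 (fun q => E ^ 2 * y2 q) cont_y1 (continuous_const.mul cont_y2) c4
  obtain ⟨U, hU, T, hT, hloc⟩ := loc_fin hk hk1 e he p hpH 1
  have d5 : ∀ᶠ q in nhds p, ∀ cd ∈ T ∩ {cd | cd ∈ Spairs k ∧ cd.1 ≠ 0},
      1 < HNorm (cd.1 : ℝ × ℝ) (cd.2 : ℝ × ℝ) q := by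
    rw [Filter.eventually_all_finite (hT.subset Set.inter_subset_left)]
    rintro cd ⟨-, hcd, hc⟩
    exact op (fun _ => 1) _ continuous_const (cont_HNorm _ _)
      (lt_of_le_of_ne (b5 cd hcd) fun h => n7 ⟨cd, hc⟩ ⟨hpH, h.symm⟩)
  rw [mem_interior_iff_mem_nhds]
  filter_upwards [hU, d1, d2, d3, d4, d5] with q hqU e1 e2 e3 e4 e5
  obtain ⟨hqH, hq⟩ := hloc q hqU
  refine ⟨⟨hqH, e1.le, e2.le, (rr1 q hqH).2 e3.le, (rr2 q hqH).2 e4.le⟩, hqH, ?_⟩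
  rintro ⟨c, d⟩ hcd
  by_cases hc : c = 0
  · subst hc
    obtain ⟨u, rfl⟩ := Spairs_zero hcd
    exact (HNorm_zero u q).ge
  · by_contra hlt
    push Not at hlt
    obtain ⟨u, hu⟩ := hq c d (Or.inl hc) hlt.le
    have := e5 _ ⟨hu, Spairs_unit u _ _ hcd, by simpa using hc⟩
    rw [HNorm_unit] at this
    linarith

/-- `F = F_∞ ∩ F₀` is a fundamental domain for the action of `Γ = PSL₂(R)`
on `H²×H²`: the boundary of `F` (in `H²×H²`) has Lebesgue measure `0`, the translates
`γ(F)` for `γ ∈ Γ` cover `H²×H²`, and for every `γ ∈ Γ` with `γ ≠ 1` in `PSL₂(R)` (i.e.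
`γ ≠ ±1` in `SL₂(R)`) there is no point `Z` with both `Z` and `γ(Z)` in the interior of `F`. -/
theorem F_isFundamentalDomain (k : ℕ) (hk : Squarefree k) (hk1 : 1 < k)
    (e : (R k)ˣ) (he : IsFundUnit k e) :
    MeasureTheory.volume (frontier (F k (eps k e)) ∩ HH) = 0 ∧
    (∀ p ∈ HH, ∃ g : SL k, p ∈ act k g '' F k (eps k e)) ∧
    (∀ g : SL k, g ≠ 1 → g.1 ≠ -1 →
      ¬ ∃ p : Pt, p ∈ interior (F k (eps k e)) ∧
        act k g p ∈ interior (F k (eps k e))) := by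
  refine ⟨null_frontier hk hk1 e he, ?_, ?_⟩
  · intro p hp
    obtain ⟨g, hg⟩ := covering hk hk1 e he p hp
    refine ⟨g⁻¹, _, hg, ?_⟩
    rw [act_mul _ _ hp, inv_mul_cancel, act_one]
  · rintro g h1 h2 ⟨p, hp, hq⟩
    rcases disjointness hk hk1 e he g p hp hq with h | h
    · exact h1 h
    · exact h2 h

end Hilbert
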